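/- Let α > 0, I = [a,T], let Ψ ∈ C¹(I) be increasing with Ψ'(t) > 0 for all t ∈ I, fix points a = t_0 < t_1 < ⋯ < t_m < t_{m+1} = T, and let β_1, …, β_m > 0 be constants. Let u, v : I → ℝ be integrable and nonnegative with v nondecreasing, and let g : I → ℝ be continuous, nonnegative and nondecreasing. If u(t) ≤ v(t) + g(t) ∫_a^t Ψ'(s)(Ψ(t) − Ψ(s))^{α−1} u(s) ds + ∑_{a < t_i < t} β_i u(t_i) for all t ∈ I, then for every k ∈ {0,1,…,m} and every t ∈ (t_k, t_{k+1}], u(t) ≤ v(t) · [ ∏_{i=1}^{k} (1 + β_i E_α(Ψ̃^α_g(t_i,a))) ] · E_α(Ψ̃^α_g(t,a)). -/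

import Mathlib

open MeasureTheory Finset

/-- The Mittag-Leffler function `E_α(z) = ∑_{k=0}^∞ z^k / Γ(αk + 1)`. -/
noncomputable def mittagLeffler (α z : ℝ) : ℝ :=
  ∑' k : ℕ, z ^ k / Real.Gamma (α * k + 1)

/-- `Ψ̃^α_g(t,s) := g(t) Γ(α) (Ψ(t) − Ψ(s))^α`. -/
noncomputable def psiTilde (α : ℝ) (g Ψ : ℝ → ℝ) (t s : ℝ) : ℝ :=
  g t * Real.Gamma α * (Ψ t - Ψ s) ^ α
open scoped ENNReal

section MittagLeffler

theorem rpow_mul_exp_neg_le_Gamma_add_one {A s : ℝ} (hA : 0 < A) (hs : 0 ≤ s) :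
    A ^ s * Real.exp (-A) ≤ Real.Gamma (s + 1) := by
  have hint := Real.GammaIntegral_convergent (s := s + 1) (by linarith)
  have hsub : Set.Ioi A ⊆ Set.Ioi (0 : ℝ) := Set.Ioi_subset_Ioi hA.le
  rw [Real.Gamma_eq_integral (by linarith), ← integral_exp_neg_Ioi A, mul_comm,
    ← integral_mul_const]
  calc ∫ x in Set.Ioi A, Real.exp (-x) * A ^ s
      ≤ ∫ x in Set.Ioi A, Real.exp (-x) * x ^ (s + 1 - 1) := by
        refine setIntegral_mono_on ((integrableOn_exp_neg_Ioi A).mul_const _)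
          (hint.mono_set hsub) measurableSet_Ioi fun x hx => ?_
        rw [add_sub_cancel_right]
        have hx' : A < x := hx
        gcongr
    _ ≤ ∫ x in Set.Ioi 0, Real.exp (-x) * x ^ (s + 1 - 1) := by
        refine setIntegral_mono_set hint ?_ hsub.eventuallyLE
        filter_upwards [ae_restrict_mem measurableSet_Ioi] with x hx
        have hx' : 0 < x := hx
        simp only [Pi.zero_apply]
        positivity

theorem summable_pow_div_Gamma {α : ℝ} (hα : 0 < α) (z : ℝ) :
    Summable fun k : ℕ => z ^ k / Real.Gamma (α * k + 1) := by
  set B : ℝ := 2 * |z| + 1 with hB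
  have hB0 : 0 < B := by positivity
  set A : ℝ := B ^ α⁻¹ with hA
  have hA0 : 0 < A := by positivity
  refine Summable.of_norm_bounded
    (g := fun k : ℕ => Real.exp A * (1 / 2 : ℝ) ^ k) (summable_geometric_two.mul_left _) fun k => ?_
  have hG := rpow_mul_exp_neg_le_Gamma_add_one hA0 (s := α * k) (by positivity)
  have hAk : A ^ (α * k) = B ^ k := by
    rw [hA, ← Real.rpow_mul hB0.le, ← mul_assoc, inv_mul_cancel₀ hα.ne', one_mul,
      Real.rpow_natCast]
  have hGpos : 0 < Real.Gamma (α * k + 1) := Real.Gamma_pos_of_pos (by positivity)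
  rw [norm_div, norm_pow, Real.norm_eq_abs, Real.norm_of_nonneg hGpos.le, div_le_iff₀ hGpos]
  calc |z| ^ k ≤ (B / 2) ^ k := by gcongr; linarith
    _ = Real.exp A * (1 / 2) ^ k * (A ^ (α * k) * Real.exp (-A)) := by
        rw [hAk, Real.exp_neg, div_pow, div_pow]; field_simp; simp
    _ ≤ _ := by gcongr

theorem mittagLeffler_nonneg {α z : ℝ} (hα : 0 < α) (hz : 0 ≤ z) : 0 ≤ mittagLeffler α z :=
  tsum_nonneg fun k => div_nonneg (pow_nonneg hz k) (Real.Gamma_nonneg_of_nonneg (by positivity))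

theorem tendsto_mul_pow_div_Gamma {α z : ℝ} (hα : 0 < α) (hz : 0 ≤ z) :
    Filter.Tendsto (fun k : ℕ => k * (z ^ k / Real.Gamma (α * k + 1))) Filter.atTop (nhds 0) := by
  refine squeeze_zero (fun k => ?_) (fun k => ?_)
    (summable_pow_div_Gamma hα (2 * z)).tendsto_atTop_zero
  · have := Real.Gamma_nonneg_of_nonneg (s := α * k + 1) (by positivity)
    positivity
  · have := Real.Gamma_nonneg_of_nonneg (s := α * k + 1) (by positivity)
    have hk : (k : ℝ) ≤ 2 ^ k := by exact_mod_cast k.lt_two_pow_self.le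
    rw [mul_pow, mul_div_assoc]
    gcongr

end MittagLeffler

section FractionalIntegral

/-- The `Ψ`-fractional integral of order `p`, with base point `a`, of a nonnegative function. -/
noncomputable def psiFracIntegral (Ψ Ψ' : ℝ → ℝ) (a p : ℝ) (f : ℝ → ℝ≥0∞) (t : ℝ) : ℝ≥0∞ :=
  ∫⁻ s in Set.Ioo a t, ENNReal.ofReal (Ψ' s * (Ψ t - Ψ s) ^ (p - 1) / Real.Gamma p) * f s

variable {Ψ Ψ' : ℝ → ℝ} {a T : ℝ}

theorem lintegral_psi_beta {r t p q : ℝ} (hrt : r < t) (hp : 0 < p) (hq : 0 < q)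
    (hderiv : ∀ s ∈ Set.Icc r t, HasDerivAt Ψ (Ψ' s) s)
    (hpos : ∀ s ∈ Set.Icc r t, 0 < Ψ' s) (hmono : StrictMonoOn Ψ (Set.Icc r t)) :
    ∫⁻ s in Set.Ioo r t, ENNReal.ofReal (Ψ' s * (Ψ t - Ψ s) ^ (p - 1) / Real.Gamma p) *
        ENNReal.ofReal ((Ψ s - Ψ r) ^ (q - 1) / Real.Gamma q) =
      ENNReal.ofReal ((Ψ t - Ψ r) ^ (p + q - 1) / Real.Gamma (p + q)) := by
  have hsub : Set.Ioo r t ⊆ Set.Icc r t := Set.Ioo_subset_Icc_self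
  have hr : r ∈ Set.Icc r t := Set.left_mem_Icc.2 hrt.le
  have ht : t ∈ Set.Icc r t := Set.right_mem_Icc.2 hrt.le
  set L : ℝ := Ψ t - Ψ r with hL
  have hL0 : 0 < L := sub_pos.2 (hmono hr ht hrt)
  have hΓp := Real.Gamma_pos_of_pos hp
  have hΓq := Real.Gamma_pos_of_pos hq
  have hΓ := Real.Gamma_pos_of_pos (add_pos hp hq)
  have himage : (fun s => (Ψ s - Ψ r) / L) '' Set.Ioo r t = Set.Ioo 0 1 := by
    ext y
    constructor
    · rintro ⟨s, hs, rfl⟩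
      have h1 := hmono hr (hsub hs) hs.1
      have h2 := hmono (hsub hs) ht hs.2
      exact ⟨div_pos (by linarith) hL0, (div_lt_one hL0).2 (by linarith)⟩
    · rintro ⟨hy0, hy1⟩
      have hcont : ContinuousOn Ψ (Set.Icc r t) :=
        fun s hs => (hderiv s hs).continuousAt.continuousWithinAt
      obtain ⟨s, hs, hsy⟩ := intermediate_value_Ioo hrt.le hcont
        (show Ψ r + y * L ∈ Set.Ioo (Ψ r) (Ψ t) from ⟨by nlinarith, by nlinarith⟩)
      exact ⟨s, hs, by simp only [hsy]; field_simp; ring⟩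
  have hone := ProbabilityTheory.lintegral_betaPDF_eq_one hq hp
  rw [ProbabilityTheory.lintegral_betaPDF, ← himage,
    lintegral_image_eq_lintegral_abs_deriv_mul (f' := fun s => Ψ' s / L) measurableSet_Ioo
      (fun s hs => (((hderiv s (hsub hs)).sub_const _).div_const _).hasDerivWithinAt)
      (fun x hx y hy hxy => hmono.injOn (hsub hx) (hsub hy)
        (by simpa [div_left_inj' hL0.ne'] using hxy))] at hone
  rw [← mul_one (ENNReal.ofReal (L ^ (p + q - 1) / Real.Gamma (p + q))), ← hone,
    ← lintegral_const_mul' _ _ ENNReal.ofReal_ne_top]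
  refine setLIntegral_congr_fun measurableSet_Ioo fun s hs => ?_
  have h1 : 0 < Ψ s - Ψ r := sub_pos.2 (hmono hr (hsub hs) hs.1)
  have h2 : 0 < Ψ t - Ψ s := sub_pos.2 (hmono (hsub hs) ht hs.2)
  have h3 := hpos s (hsub hs)
  rw [abs_of_pos (by positivity), ← ENNReal.ofReal_mul (by positivity),
    ← ENNReal.ofReal_mul (by positivity), ← ENNReal.ofReal_mul (by positivity)]
  congr 1
  have h4 : 1 - (Ψ s - Ψ r) / L = (Ψ t - Ψ s) / L := by field_simp; rw [hL]; ring
  have h5 : L ^ (p + q - 1) = L ^ (q - 1) * L ^ (p - 1) * L := by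
    rw [← Real.rpow_add hL0, ← Real.rpow_add_one hL0.ne']; congr 1; ring
  rw [h4, Real.div_rpow h1.le hL0.le, Real.div_rpow h2.le hL0.le, h5, ProbabilityTheory.beta,
    add_comm q p]
  have := (Real.rpow_pos_of_pos hL0 (q - 1)).ne'
  have := (Real.rpow_pos_of_pos hL0 (p - 1)).ne'
  field_simp

theorem psiFracIntegral_const {t p : ℝ} (c : ℝ≥0∞) (hat : a < t) (hp : 0 < p)
    (hderiv : ∀ s ∈ Set.Icc a t, HasDerivAt Ψ (Ψ' s) s)
    (hpos : ∀ s ∈ Set.Icc a t, 0 < Ψ' s) (hmono : StrictMonoOn Ψ (Set.Icc a t))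
    (hcont : ContinuousOn Ψ' (Set.Icc a t)) :
    psiFracIntegral Ψ Ψ' a p (fun _ => c) t =
      ENNReal.ofReal ((Ψ t - Ψ a) ^ p / Real.Gamma (p + 1)) * c := by
  have h := lintegral_psi_beta hat hp one_pos hderiv hpos hmono
  simp only [sub_self, Real.rpow_zero, Real.Gamma_one, div_one, ENNReal.ofReal_one, mul_one,
    add_sub_cancel_right] at h
  have hΨ : ContinuousOn Ψ (Set.Ioo a t) := fun s hs =>
    (hderiv s (Set.Ioo_subset_Icc_self hs)).continuousAt.continuousWithinAt
  rw [psiFracIntegral, lintegral_mul_const'', h]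
  have h1 := hΨ.aemeasurable (μ := volume) measurableSet_Ioo
  have h2 := (hcont.mono Set.Ioo_subset_Icc_self).aemeasurable (μ := volume) measurableSet_Ioo
  fun_prop

theorem psiFracIntegral_psiFracIntegral {t p q : ℝ} {f : ℝ → ℝ≥0∞} (hp : 0 < p) (hq : 0 < q)
    (hderiv : ∀ s ∈ Set.Icc a t, HasDerivAt Ψ (Ψ' s) s)
    (hpos : ∀ s ∈ Set.Icc a t, 0 < Ψ' s) (hmono : StrictMonoOn Ψ (Set.Icc a t))
    (hcont : ContinuousOn Ψ' (Set.Icc a t))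
    (hf : AEMeasurable f (volume.restrict (Set.Icc a t))) :
    psiFracIntegral Ψ Ψ' a p (psiFracIntegral Ψ Ψ' a q f) t =
      psiFracIntegral Ψ Ψ' a (p + q) f t := by
  set μ := volume.restrict (Set.Ioo a t) with hμ
  have hsub : Set.Ioo a t ⊆ Set.Icc a t := Set.Ioo_subset_Icc_self
  have hΨ : AEMeasurable Ψ μ := ContinuousOn.aemeasurable
    (fun s hs => (hderiv s (hsub hs)).continuousAt.continuousWithinAt) measurableSet_Ioo
  have hΨ' : AEMeasurable Ψ' μ := (hcont.mono hsub).aemeasurable measurableSet_Ioo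
  have hfμ : AEMeasurable f μ := hf.mono_measure (Measure.restrict_mono hsub le_rfl)
  set K : ℝ → ℝ≥0∞ := fun s => ENNReal.ofReal (Ψ' s * (Ψ t - Ψ s) ^ (p - 1) / Real.Gamma p) with hK
  set J : ℝ → ℝ → ℝ≥0∞ := fun s r =>
    ENNReal.ofReal (Ψ' r * (Ψ s - Ψ r) ^ (q - 1) / Real.Gamma q) * f r with hJ
  have hKm : AEMeasurable K μ := by fun_prop
  set F : ℝ → ℝ → ℝ≥0∞ := fun s r => {x : ℝ × ℝ | x.2 < x.1}.indicator
    (fun x => K x.1 * J x.1 x.2) (s, r) with hF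
  have hFm : AEMeasurable (Function.uncurry F) (μ.prod μ) := by
    have e : Function.uncurry F = {x : ℝ × ℝ | x.2 < x.1}.indicator
      (fun x => K x.1 * J x.1 x.2) := rfl
    rw [e]
    refine AEMeasurable.indicator ?_ (measurableSet_lt measurable_snd measurable_fst)
    have m1 : AEMeasurable (fun x : ℝ × ℝ => Ψ x.1) (μ.prod μ) := hΨ.comp_fst
    have m2 : AEMeasurable (fun x : ℝ × ℝ => Ψ x.2) (μ.prod μ) := hΨ.comp_snd
    have m3 : AEMeasurable (fun x : ℝ × ℝ => Ψ' x.2) (μ.prod μ) := hΨ'.comp_snd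
    have m4 : AEMeasurable (fun x : ℝ × ℝ => f x.2) (μ.prod μ) := hfμ.comp_snd
    have m5 : AEMeasurable (fun x : ℝ × ℝ => K x.1) (μ.prod μ) := hKm.comp_fst
    exact m5.mul (((m3.mul ((m1.sub m2).pow_const _)).div_const _).ennreal_ofReal.mul m4)
  have hleft : psiFracIntegral Ψ Ψ' a p (psiFracIntegral Ψ Ψ' a q f) t =
      ∫⁻ s, ∫⁻ r, F s r ∂μ ∂μ := by
    refine setLIntegral_congr_fun measurableSet_Ioo fun s hs => ?_
    have e1 : ∀ r, F s r = (Set.Iio s).indicator (fun r => K s * J s r) r := fun r => rfl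
    simp only [e1]
    rw [lintegral_indicator measurableSet_Iio, hμ, Measure.restrict_restrict measurableSet_Iio,
      lintegral_const_mul' _ _ ENNReal.ofReal_ne_top]
    have e2 : Set.Iio s ∩ Set.Ioo a t = Set.Ioo a s := by
      ext r; simp only [Set.mem_inter_iff, Set.mem_Iio, Set.mem_Ioo]
      have := hs.2
      grind
    rw [e2]
    rfl
  rw [hleft, lintegral_lintegral_swap hFm]
  refine setLIntegral_congr_fun measurableSet_Ioo fun r hr => ?_
  have e1 : ∀ s, F s r = (Set.Ioi r).indicator (fun s => K s * J s r) s := fun s => rfl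
  simp only [e1]
  rw [lintegral_indicator measurableSet_Ioi, hμ, Measure.restrict_restrict measurableSet_Ioi]
  have e2 : Set.Ioi r ∩ Set.Ioo a t = Set.Ioo r t := by
    ext s; simp only [Set.mem_inter_iff, Set.mem_Ioi, Set.mem_Ioo]
    have := hr.1
    grind
  have hrt : Set.Icc r t ⊆ Set.Icc a t := Set.Icc_subset_Icc_left hr.1.le
  have hb := lintegral_psi_beta hr.2 hp hq (fun s hs => hderiv s (hrt hs))
    (fun s hs => hpos s (hrt hs)) (hmono.mono hrt)
  have hr0 := (hpos r (hsub hr)).le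
  have e3 : ∀ s, K s * J s r = ENNReal.ofReal (Ψ' s * (Ψ t - Ψ s) ^ (p - 1) / Real.Gamma p) *
        ENNReal.ofReal ((Ψ s - Ψ r) ^ (q - 1) / Real.Gamma q) * (ENNReal.ofReal (Ψ' r) * f r) := by
    intro s
    simp only [hK, hJ]
    rw [mul_div_assoc (Ψ' r), ENNReal.ofReal_mul hr0]
    ring
  simp only [e2, e3]
  rw [lintegral_mul_const'', hb, mul_div_assoc (Ψ' r), ENNReal.ofReal_mul hr0]
  · ring
  · have hsub' : Set.Ioo r t ⊆ Set.Ioo a t := Set.Ioo_subset_Ioo_left hr.1.le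
    have m1 := hΨ.mono_measure (Measure.restrict_mono hsub' le_rfl)
    have m2 := hΨ'.mono_measure (Measure.restrict_mono hsub' le_rfl)
    fun_prop

theorem le_sum_add_psiFracIntegral {α t : ℝ} {f : ℝ → ℝ≥0∞} {W c : ℝ≥0∞} (hα : 0 < α)
    (hat : a < t) (hc : c ≠ ∞)
    (hderiv : ∀ s ∈ Set.Icc a t, HasDerivAt Ψ (Ψ' s) s)
    (hpos : ∀ s ∈ Set.Icc a t, 0 < Ψ' s) (hmono : StrictMonoOn Ψ (Set.Icc a t))
    (hcont : ContinuousOn Ψ' (Set.Icc a t))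
    (hf : AEMeasurable f (volume.restrict (Set.Icc a t)))
    (hle : ∀ s ∈ Set.Icc a t, f s ≤ W + c * psiFracIntegral Ψ Ψ' a α f s) (n : ℕ) :
    f t ≤ ∑ j ∈ range (n + 1),
        c ^ j * (ENNReal.ofReal ((Ψ t - Ψ a) ^ (α * j) / Real.Gamma (α * j + 1)) * W) +
      c ^ (n + 1) * psiFracIntegral Ψ Ψ' a (α * (n + 1 : ℕ)) f t := by
  induction n with
  | zero => simpa using hle t (Set.right_mem_Icc.2 hat.le)
  | succ n ih =>
    refine ih.trans ?_
    rw [sum_range_succ _ (n + 1), add_assoc]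
    gcongr
    set p : ℝ := α * (n + 1 : ℕ) with hp
    have hp0 : 0 < p := by positivity
    have hsub : Set.Ioo a t ⊆ Set.Icc a t := Set.Ioo_subset_Icc_self
    have hΨ : AEMeasurable Ψ (volume.restrict (Set.Ioo a t)) := ContinuousOn.aemeasurable
      (fun s hs => (hderiv s (hsub hs)).continuousAt.continuousWithinAt) measurableSet_Ioo
    have hΨ' : AEMeasurable Ψ' (volume.restrict (Set.Ioo a t)) :=
      (hcont.mono hsub).aemeasurable measurableSet_Ioo
    have hstep : psiFracIntegral Ψ Ψ' a p f t ≤ psiFracIntegral Ψ Ψ' a p (fun _ => W) t +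
        c * psiFracIntegral Ψ Ψ' a p (psiFracIntegral Ψ Ψ' a α f) t := by
      simp only [psiFracIntegral]
      rw [← lintegral_const_mul' _ _ hc, ← lintegral_add_left' (by fun_prop)]
      refine setLIntegral_mono' measurableSet_Ioo fun s hs => ?_
      refine (mul_le_mul_right (hle s (hsub hs)) _).trans_eq ?_
      simp only [psiFracIntegral]
      ring
    rw [psiFracIntegral_const W hat hp0 hderiv hpos hmono hcont,
      psiFracIntegral_psiFracIntegral hp0 hα hderiv hpos hmono hcont hf] at hstep
    calc c ^ (n + 1) * psiFracIntegral Ψ Ψ' a p f t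
        ≤ c ^ (n + 1) * (ENNReal.ofReal ((Ψ t - Ψ a) ^ p / Real.Gamma (p + 1)) * W +
          c * psiFracIntegral Ψ Ψ' a (p + α) f t) := by gcongr
      _ = _ := by
        rw [show α * ((n + 1 + 1 : ℕ) : ℝ) = p + α by rw [hp]; push_cast; ring]
        ring

theorem psiFracIntegral_le_of_one_le {t p : ℝ} {f : ℝ → ℝ≥0∞} (hp : 1 ≤ p)
    (hpos : ∀ s ∈ Set.Icc a t, 0 < Ψ' s) (hmono : StrictMonoOn Ψ (Set.Icc a t)) :
    psiFracIntegral Ψ Ψ' a p f t ≤ ENNReal.ofReal ((Ψ t - Ψ a) ^ (p - 1) / Real.Gamma p) *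
      ∫⁻ s in Set.Ioo a t, ENNReal.ofReal (Ψ' s) * f s := by
  rw [psiFracIntegral, ← lintegral_const_mul' _ _ ENNReal.ofReal_ne_top]
  refine setLIntegral_mono' measurableSet_Ioo fun s hs => ?_
  have hs' := Set.Ioo_subset_Icc_self hs
  have hat : a ≤ t := (hs.1.trans hs.2).le
  have h1 := hmono (Set.left_mem_Icc.2 hat) hs' hs.1
  have h2 := hmono hs' (Set.right_mem_Icc.2 hat) hs.2
  have h3 := (hpos s hs').le
  have hΓ := Real.Gamma_pos_of_pos (zero_lt_one.trans_le hp)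
  rw [mul_div_assoc, ENNReal.ofReal_mul h3, mul_comm (ENNReal.ofReal (Ψ' s)), mul_assoc]
  gcongr

theorem tendsto_pow_mul_psiFracIntegral {α t c : ℝ} {f : ℝ → ℝ≥0∞} (hα : 0 < α) (hat : a < t)
    (hc : 0 ≤ c) (hpos : ∀ s ∈ Set.Icc a t, 0 < Ψ' s) (hmono : StrictMonoOn Ψ (Set.Icc a t))
    (hf : ∫⁻ s in Set.Ioo a t, ENNReal.ofReal (Ψ' s) * f s ≠ ∞) :
    Filter.Tendsto (fun n : ℕ => ENNReal.ofReal c ^ n * psiFracIntegral Ψ Ψ' a (α * n) f t)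
      Filter.atTop (nhds 0) := by
  set L : ℝ := Ψ t - Ψ a with hL
  have hL0 : 0 < L :=
    sub_pos.2 (hmono (Set.left_mem_Icc.2 hat.le) (Set.right_mem_Icc.2 hat.le) hat)
  have hlim : Filter.Tendsto (fun n : ℕ => ENNReal.ofReal (α / L *
      (n * ((c * L ^ α) ^ n / Real.Gamma (α * n + 1)))) *
      ∫⁻ s in Set.Ioo a t, ENNReal.ofReal (Ψ' s) * f s) Filter.atTop (nhds 0) := by
    have h := ENNReal.tendsto_ofReal
      ((tendsto_mul_pow_div_Gamma hα (z := c * L ^ α) (by positivity)).const_mul (α / L))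
    simpa using ENNReal.Tendsto.mul_const h (Or.inr hf)
  refine tendsto_of_tendsto_of_tendsto_of_le_of_le' tendsto_const_nhds hlim
    (Filter.Eventually.of_forall fun _ => zero_le) ?_
  filter_upwards [Filter.eventually_ge_atTop ⌈α⁻¹⌉₊] with n hn
  have hp : 1 ≤ α * n := by
    rw [← inv_mul_le_iff₀ hα, mul_one]
    exact Nat.ceil_le.1 hn
  have hp0 : 0 < α * n := by linarith
  refine (mul_le_mul_right (psiFracIntegral_le_of_one_le hp hpos hmono) _).trans_eq ?_
  rw [← mul_assoc, ← ENNReal.ofReal_pow hc, ← ENNReal.ofReal_mul (by positivity)]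
  congr 2
  have hΓ := Real.Gamma_pos_of_pos hp0
  rw [Real.Gamma_add_one hp0.ne', mul_pow, ← Real.rpow_natCast (L ^ α), ← Real.rpow_mul hL0.le,
    Real.rpow_sub_one hL0.ne']
  have hn0 : (n : ℝ) ≠ 0 := by rintro h; simp [h] at hp0
  field_simp

/-- The `Ψ`-fractional Gronwall inequality with constant coefficients. -/
theorem le_mul_mittagLeffler_of_le_psiFracIntegral {α t W c : ℝ} {f : ℝ → ℝ≥0∞} (hα : 0 < α)
    (hat : a < t) (hW : 0 ≤ W) (hc : 0 ≤ c)
    (hderiv : ∀ s ∈ Set.Icc a t, HasDerivAt Ψ (Ψ' s) s)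
    (hpos : ∀ s ∈ Set.Icc a t, 0 < Ψ' s) (hmono : StrictMonoOn Ψ (Set.Icc a t))
    (hcont : ContinuousOn Ψ' (Set.Icc a t))
    (hf : AEMeasurable f (volume.restrict (Set.Icc a t)))
    (hfin : ∫⁻ s in Set.Ioo a t, ENNReal.ofReal (Ψ' s) * f s ≠ ∞)
    (hle : ∀ s ∈ Set.Icc a t,
      f s ≤ ENNReal.ofReal W + ENNReal.ofReal c * psiFracIntegral Ψ Ψ' a α f s) :
    f t ≤ ENNReal.ofReal (W * mittagLeffler α (c * (Ψ t - Ψ a) ^ α)) := by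
  have hL0 : 0 < Ψ t - Ψ a :=
    sub_pos.2 (hmono (Set.left_mem_Icc.2 hat.le) (Set.right_mem_Icc.2 hat.le) hat)
  have hlim := ((tendsto_pow_mul_psiFracIntegral hα hat hc hpos hmono hfin).comp
    (Filter.tendsto_add_atTop_nat 1)).const_add
      (ENNReal.ofReal (W * mittagLeffler α (c * (Ψ t - Ψ a) ^ α)))
  rw [add_zero] at hlim
  refine ge_of_tendsto' hlim fun n => ?_
  refine (le_sum_add_psiFracIntegral hα hat ENNReal.ofReal_ne_top hderiv hpos hmono hcont hf
    hle n).trans ?_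
  refine add_le_add_left ?_ _
  have hΓ : ∀ j : ℕ, 0 < Real.Gamma (α * j + 1) := fun j => Real.Gamma_pos_of_pos (by positivity)
  have hterm : ∀ j : ℕ, ENNReal.ofReal c ^ j *
      (ENNReal.ofReal ((Ψ t - Ψ a) ^ (α * j) / Real.Gamma (α * j + 1)) * ENNReal.ofReal W) =
      ENNReal.ofReal (W * ((c * (Ψ t - Ψ a) ^ α) ^ j / Real.Gamma (α * j + 1))) := by
    intro j
    have := hΓ j
    rw [← ENNReal.ofReal_pow hc, ← ENNReal.ofReal_mul (by positivity),
      ← ENNReal.ofReal_mul (by positivity), mul_pow, ← Real.rpow_natCast ((Ψ t - Ψ a) ^ α),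
      ← Real.rpow_mul hL0.le]
    congr 1
    ring
  have hnn : ∀ j : ℕ, 0 ≤ (c * (Ψ t - Ψ a) ^ α) ^ j / Real.Gamma (α * j + 1) := fun j => by
    have := hΓ j
    positivity
  simp only [hterm]
  rw [← ENNReal.ofReal_sum_of_nonneg fun j _ => mul_nonneg hW (hnn j), ← mul_sum]
  gcongr
  exact (summable_pow_div_Gamma hα _).sum_le_tsum _ fun j _ => hnn j

/-- The `Ψ`-fractional Gronwall inequality with nondecreasing coefficients. -/
theorem le_mul_mittagLeffler_of_le_integral {α : ℝ} {u w g : ℝ → ℝ} (hα : 0 < α)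
    (hderiv : ∀ s ∈ Set.Icc a T, HasDerivAt Ψ (Ψ' s) s)
    (hpos : ∀ s ∈ Set.Icc a T, 0 < Ψ' s) (hmono : StrictMonoOn Ψ (Set.Icc a T))
    (hcont : ContinuousOn Ψ' (Set.Icc a T))
    (hu_int : IntegrableOn u (Set.Icc a T)) (hu_nonneg : ∀ t ∈ Set.Icc a T, 0 ≤ u t)
    (hw_nonneg : ∀ t ∈ Set.Icc a T, 0 ≤ w t) (hw_mono : MonotoneOn w (Set.Icc a T))
    (hg_nonneg : ∀ t ∈ Set.Icc a T, 0 ≤ g t) (hg_mono : MonotoneOn g (Set.Icc a T))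
    (hineq : ∀ t ∈ Set.Icc a T,
      u t ≤ w t + g t * ∫ s in a..t, Ψ' s * (Ψ t - Ψ s) ^ (α - 1) * u s)
    {t : ℝ} (ht : t ∈ Set.Ioc a T) :
    u t ≤ w t * mittagLeffler α (psiTilde α g Ψ t a) := by
  have ht' : t ∈ Set.Icc a T := Set.Ioc_subset_Icc_self ht
  have hsub : Set.Icc a t ⊆ Set.Icc a T := Set.Icc_subset_Icc_right ht.2
  have hΓ := Real.Gamma_pos_of_pos hα
  have hc : 0 ≤ g t * Real.Gamma α := mul_nonneg (hg_nonneg t ht') hΓ.le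
  have hL : 0 ≤ Ψ t - Ψ a :=
    sub_nonneg.2 (hmono.monotoneOn (Set.left_mem_Icc.2 (ht'.1.trans ht'.2)) ht' ht'.1)
  have hE : 0 ≤ mittagLeffler α (psiTilde α g Ψ t a) :=
    mittagLeffler_nonneg hα (mul_nonneg hc (Real.rpow_nonneg hL _))
  have hui := hu_int.mono_set hsub
  rw [← ENNReal.ofReal_le_ofReal_iff (mul_nonneg (hw_nonneg t ht') hE)]
  refine le_mul_mittagLeffler_of_le_psiFracIntegral (f := fun s => ENNReal.ofReal (u s)) hα ht.1
    (hw_nonneg t ht') hc (fun s hs => hderiv s (hsub hs)) (fun s hs => hpos s (hsub hs))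
    (hmono.mono hsub) (hcont.mono hsub) hui.aemeasurable.ennreal_ofReal ?_ fun s hs => ?_
  · have hprod : IntegrableOn (fun s => Ψ' s * u s) (Set.Icc a t) :=
      hui.continuousOn_mul (hcont.mono hsub) isCompact_Icc
    have hlt := (hprod.mono_set Set.Ioo_subset_Icc_self).lintegral_lt_top
    refine ne_of_lt (lt_of_eq_of_lt (setLIntegral_congr_fun measurableSet_Ioo fun s hs => ?_) hlt)
    exact (ENNReal.ofReal_mul (hpos s (hsub (Set.Ioo_subset_Icc_self hs))).le).symm
  · have hsT := hsub hs
    have hI : ENNReal.ofReal (∫ r in a..s, Ψ' r * (Ψ s - Ψ r) ^ (α - 1) * u r) ≤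
        ENNReal.ofReal (Real.Gamma α) *
          psiFracIntegral Ψ Ψ' a α (fun r => ENNReal.ofReal (u r)) s := by
      rw [intervalIntegral.integral_of_le hs.1, integral_Ioc_eq_integral_Ioo, psiFracIntegral,
        ← lintegral_const_mul' _ _ ENNReal.ofReal_ne_top]
      refine (Real.ofReal_le_enorm _).trans ((enorm_integral_le_lintegral_enorm _).trans_eq ?_)
      refine setLIntegral_congr_fun measurableSet_Ioo fun r hr => ?_
      have hrT : r ∈ Set.Icc a T := ⟨hr.1.le, hr.2.le.trans hsT.2⟩
      have h1 := hpos r hrT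
      have h2 := hu_nonneg r hrT
      have h3 : 0 < Ψ s - Ψ r := sub_pos.2 (hmono hrT hsT hr.2)
      rw [Real.enorm_eq_ofReal (by positivity), ← ENNReal.ofReal_mul (by positivity),
        ← ENNReal.ofReal_mul (by positivity)]
      congr 1
      field_simp
    calc ENNReal.ofReal (u s)
        ≤ ENNReal.ofReal (w s) + ENNReal.ofReal (g s) *
            ENNReal.ofReal (∫ r in a..s, Ψ' r * (Ψ s - Ψ r) ^ (α - 1) * u r) := by
          rw [← ENNReal.ofReal_mul (hg_nonneg s hsT)]
          exact (ENNReal.ofReal_le_ofReal (hineq s hsT)).trans ENNReal.ofReal_add_le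
      _ ≤ ENNReal.ofReal (w t) + ENNReal.ofReal (g t) * (ENNReal.ofReal (Real.Gamma α) *
            psiFracIntegral Ψ Ψ' a α (fun r => ENNReal.ofReal (u r)) s) := by
          gcongr
          · exact hw_mono hsT ht' hs.2
          · exact hg_mono hsT ht' hs.2
      _ = _ := by rw [← mul_assoc, ← ENNReal.ofReal_mul (hg_nonneg t ht')]

end FractionalIntegral

theorem one_add_sum_mul_prod_one_add (x : ℕ → ℝ) (k : ℕ) :
    1 + ∑ i ∈ Icc 1 k, x i * ∏ j ∈ Icc 1 (i - 1), (1 + x j) = ∏ i ∈ Icc 1 k, (1 + x i) := by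
  induction k with
  | zero => simp
  | succ k ih =>
    rw [sum_Icc_succ_top (by omega), prod_Icc_succ_top (by omega), ← add_assoc, ih,
      Nat.add_sub_cancel]
    ring

/-- Corollary 2 of the paper: impulsive Ψ-fractional Gronwall inequality
    without the `δ u(t)` term, with nondecreasing `v`. -/
theorem impulsive_psi_fractional_gronwall_no_delta
    (α a T : ℝ) (hα : 0 < α) (haT : a < T)
    (Ψ Ψ' : ℝ → ℝ)
    (hΨderiv : ∀ t ∈ Set.Icc a T, HasDerivAt Ψ (Ψ' t) t)
    (hΨ'cont : ContinuousOn Ψ' (Set.Icc a T))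
    (hΨ'pos : ∀ t ∈ Set.Icc a T, 0 < Ψ' t)
    (hΨmono : StrictMonoOn Ψ (Set.Icc a T))
    (m : ℕ) (tp : ℕ → ℝ)
    (htp0 : tp 0 = a) (htpT : tp (m + 1) = T)
    (htp_mono : ∀ i ≤ m, tp i < tp (i + 1))
    (β : ℕ → ℝ) (hβ : ∀ i, 1 ≤ i → i ≤ m → 0 < β i)
    (u v g : ℝ → ℝ)
    (hu_int : IntegrableOn u (Set.Icc a T))
    (hv_int : IntegrableOn v (Set.Icc a T))
    (hu_nonneg : ∀ t ∈ Set.Icc a T, 0 ≤ u t)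
    (hv_nonneg : ∀ t ∈ Set.Icc a T, 0 ≤ v t)
    (hv_mono : MonotoneOn v (Set.Icc a T))
    (hg_cont : ContinuousOn g (Set.Icc a T))
    (hg_nonneg : ∀ t ∈ Set.Icc a T, 0 ≤ g t)
    (hg_mono : MonotoneOn g (Set.Icc a T))
    (hineq : ∀ t ∈ Set.Icc a T,
      u t ≤ v t + g t * (∫ s in a..t, Ψ' s * (Ψ t - Ψ s) ^ (α - 1) * u s) +
        ∑ i ∈ (Finset.Icc 1 m).filter (fun i => tp i < t), β i * u (tp i)) :
    ∀ k ≤ m, ∀ t ∈ Set.Ioc (tp k) (tp (k + 1)),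
      u t ≤ v t *
        (∏ i ∈ Finset.Icc 1 k, (1 + β i * mittagLeffler α (psiTilde α g Ψ (tp i) a))) *
        mittagLeffler α (psiTilde α g Ψ t a) := by
  have hmono_tp : ∀ j ≤ m + 1, ∀ i ≤ j, tp i ≤ tp j := by
    intro j
    induction j with
    | zero => intro _ i hi; rw [Nat.le_zero.1 hi]
    | succ j ih =>
      intro hj i hi
      rcases Nat.le_succ_iff.1 hi with h | rfl
      · exact (ih (by omega) i h).trans (htp_mono j (by omega)).le
      · exact le_rfl
  have htp_mem : ∀ i ≤ m + 1, tp i ∈ Set.Icc a T := fun i hi =>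
    ⟨htp0 ▸ hmono_tp i hi 0 (Nat.zero_le i), htpT ▸ hmono_tp (m + 1) le_rfl i hi⟩
  have hE : ∀ t ∈ Set.Icc a T, 0 ≤ mittagLeffler α (psiTilde α g Ψ t a) := fun t ht =>
    mittagLeffler_nonneg hα (mul_nonneg
      (mul_nonneg (hg_nonneg t ht) (Real.Gamma_nonneg_of_nonneg hα.le))
      (Real.rpow_nonneg (sub_nonneg.2
        (hΨmono.monotoneOn (Set.left_mem_Icc.2 haT.le) ht ht.1)) _))
  have hterm : ∀ i ∈ Icc 1 m, 0 ≤ β i * u (tp i) := fun i hi => by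
    rw [mem_Icc] at hi
    exact mul_nonneg (hβ i hi.1 hi.2).le (hu_nonneg _ (htp_mem i (by omega)))
  set S : ℝ → ℝ := fun t => ∑ i ∈ (Icc 1 m).filter (fun i => tp i < t), β i * u (tp i) with hS
  have hS_mono : Monotone S := fun s t hst =>
    sum_le_sum_of_subset_of_nonneg
      (monotone_filter_right _ fun i hi (h : tp i < s) => h.trans_le hst)
      fun i hi _ => hterm i (mem_filter.1 hi).1
  have hS_nonneg : ∀ t, 0 ≤ S t := fun t => sum_nonneg fun i hi => hterm i (mem_filter.1 hi).1
  have key : ∀ t ∈ Set.Ioc a T, u t ≤ (v t + S t) * mittagLeffler α (psiTilde α g Ψ t a) :=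
    fun t ht => le_mul_mittagLeffler_of_le_integral (w := fun t => v t + S t) hα hΨderiv hΨ'pos
      hΨmono hΨ'cont hu_int hu_nonneg (fun t ht => add_nonneg (hv_nonneg t ht) (hS_nonneg t))
      (hv_mono.add (hS_mono.monotoneOn _)) hg_nonneg hg_mono
      (fun t ht => (hineq t ht).trans_eq (add_right_comm _ _ _)) ht
  intro k
  induction k using Nat.strong_induction_on with
  | _ k ih =>
  intro hk t ht
  have htk := htp_mem k (by omega)
  have htk1 := htp_mem (k + 1) (by omega)
  have htI : t ∈ Set.Ioc a T := ⟨htk.1.trans_lt ht.1, ht.2.trans htk1.2⟩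
  have htI' := Set.Ioc_subset_Icc_self htI
  refine (key t htI).trans (mul_le_mul_of_nonneg_right ?_ (hE t htI'))
  have hfilter : (Icc 1 m).filter (fun i => tp i < t) = Icc 1 k := by
    ext i
    simp only [mem_filter, mem_Icc]
    constructor
    · rintro ⟨⟨h1, h2⟩, h3⟩
      refine ⟨h1, ?_⟩
      by_contra! h
      exact absurd (ht.2.trans (hmono_tp i (by omega) (k + 1) h)) (not_le.2 h3)
    · rintro ⟨h1, h2⟩
      exact ⟨⟨h1, h2.trans hk⟩, (hmono_tp k (by omega) i h2).trans_lt ht.1⟩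
  rw [← one_add_sum_mul_prod_one_add, mul_add, mul_one, mul_sum]
  simp only [hS, hfilter]
  refine add_le_add le_rfl (sum_le_sum fun i hi => ?_)
  rw [mem_Icc] at hi
  have hi' := htp_mem i (by omega)
  have hβi := (hβ i hi.1 (by omega)).le
  have hprod : 0 ≤ ∏ j ∈ Icc 1 (i - 1),
      (1 + β j * mittagLeffler α (psiTilde α g Ψ (tp j) a)) := prod_nonneg fun j hj => by
    rw [mem_Icc] at hj
    exact add_nonneg zero_le_one
      (mul_nonneg (hβ j hj.1 (by omega)).le (hE _ (htp_mem j (by omega))))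
  have hui := ih (i - 1) (by omega) (by omega) (tp i) (by
    rw [Nat.sub_add_cancel hi.1]
    have := htp_mono (i - 1) (by omega)
    rw [Nat.sub_add_cancel hi.1] at this
    exact ⟨this, le_rfl⟩)
  have hvi : v (tp i) ≤ v t :=
    hv_mono hi' htI' ((hmono_tp k (by omega) i hi.2).trans ht.1.le)
  have hEi := hE _ hi'
  calc β i * u (tp i) ≤ β i * (v t * (∏ j ∈ Icc 1 (i - 1),
        (1 + β j * mittagLeffler α (psiTilde α g Ψ (tp j) a))) *
          mittagLeffler α (psiTilde α g Ψ (tp i) a)) := by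
        gcongr
        exact hui.trans (by gcongr)
    _ = _ := by ring
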